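/- Let k be an algebraically closed field of characteristic zero. Then the universal Novikov field Λ over k is an algebraically closed field: the set of Hahn series over k with value group ℝ whose support meets every half-line (−∞, r] in a finite set is a subfield of the field of Hahn series, and every polynomial of positive degree with coefficients in this subfield has a root in this subfield. -/

import Mathlib

section Valued

open Polynomial

variable {k K L : Type*} [Field k] [NontriviallyNormedField K] [IsUltrametricDist K]
  [Field L] [Algebra K L] [Algebra.IsAlgebraic K L]

lemma spectralNorm_multiset_sum_lt_one (m : Multiset L) (h : ∀ x ∈ m, spectralNorm K L x < 1) :
    spectralNorm K L m.sum < 1 := by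
  induction m using Multiset.induction_on with
  | empty => simp [spectralNorm_zero]
  | cons a m ih =>
    rw [Multiset.sum_cons]
    exact (isNonarchimedean_spectralNorm a m.sum).trans_lt (max_lt (h a (by simp))
      (ih fun x hx => h x (Multiset.mem_cons_of_mem hx)))

/-- If the residue field of `K` is represented by an algebraically closed subfield `k`, then `k`
also represents the residue field of every algebraic extension of `K`. -/
lemma exists_spectralNorm_sub_lt_one [CompleteSpace K] [IsAlgClosed k] (i : k →+* K)
    (hres : ∀ x : K, ‖x‖ ≤ 1 → ∃ c : k, ‖x - i c‖ < 1) (z : L) (hz : spectralNorm K L z ≤ 1) :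
    ∃ c : k, spectralNorm K L (z - algebraMap K L (i c)) < 1 := by
  have hint : IsIntegral K z := Algebra.IsIntegral.isIntegral z
  have hmon := minpoly.monic hint
  have hcoeff := (spectralValue_le_one_iff hmon).1 hz
  choose c hc using fun n => hres _ (hcoeff n)
  set n := (minpoly K z).natDegree with hn
  set Q : k[X] := X ^ n + ∑ m ∈ Finset.range n, C (c m) * X ^ m with hQ
  have hQm : Q.Monic := by
    refine monic_X_pow_add ((degree_sum_le _ _).trans_lt ?_)
    rw [Finset.sup_lt_iff (by simp)]
    intro m hm
    exact (degree_C_mul_X_pow_le _ _).trans_lt (by simpa using hm)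
  have hQz : spectralNorm K L (Q.eval₂ ((algebraMap K L).comp i) z) < 1 := by
    have h0 := minpoly.aeval K z
    rw [hmon.as_sum] at h0
    have : Q.eval₂ ((algebraMap K L).comp i) z = (Multiset.map (fun m =>
        - (algebraMap K L ((minpoly K z).coeff m - i (c m)) * z ^ m)) (Multiset.range n)).sum := by
      rw [← sub_zero (eval₂ _ _ _), ← h0]
      simp only [hQ, eval₂_add, eval₂_pow, eval₂_X, eval₂_finsetSum, eval₂_mul, eval₂_C,
        map_add, map_pow, aeval_X, map_sum, map_mul, aeval_C, ← hn, RingHom.comp_apply, map_sub]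
      rw [add_sub_add_left_eq_sub, ← Finset.sum_sub_distrib, Finset.sum, Finset.range_val]
      congr 2
      ext m
      ring
    rw [this]
    refine spectralNorm_multiset_sum_lt_one _ fun x hx => ?_
    obtain ⟨m, -, rfl⟩ := Multiset.mem_map.1 hx
    rw [← spectralMulAlgNorm_def, map_neg_eq_map, map_mul, map_pow, spectralMulAlgNorm_def,
      spectralMulAlgNorm_def, spectralNorm_extends]
    exact (mul_le_of_le_one_right (norm_nonneg _)
      (pow_le_one₀ (spectralNorm_nonneg _) hz)).trans_lt (hc m)
  by_contra! hcon
  refine hQz.not_ge ?_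
  rw [(IsAlgClosed.splits Q).eq_prod_roots_of_monic hQm, eval₂_multiset_prod, Multiset.map_map,
    ← spectralMulAlgNorm_def, map_multiset_prod, Multiset.map_map]
  refine Multiset.one_le_prod_map fun r _ => ?_
  simpa [spectralMulAlgNorm_def] using hcon r

/-- A complete nonarchimedean field of residue characteristic zero with divisible value group,
whose residue field is represented by an algebraically closed subfield, is algebraically closed. -/
theorem isAlgClosed_of_residue [CompleteSpace K] [IsAlgClosed k] [CharZero k] (i : k →+* K)
    (hres : ∀ x : K, ‖x‖ ≤ 1 → ∃ c : k, ‖x - i c‖ < 1) (hunit : ∀ c : k, c ≠ 0 → ‖i c‖ = 1)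
    (hdiv : ∀ (x : K) (n : ℕ), n ≠ 0 → ∃ u : K, ‖u‖ ^ n = ‖x‖) : IsAlgClosed K := by
  have : CharZero K := charZero_of_injective_ringHom i.injective
  refine IsAlgClosed.of_exists_root _ fun p hp hirr => ?_
  let L := AlgebraicClosure K
  let f := spectralMulAlgNorm K L
  have hf (x : K) : f (algebraMap K L x) = ‖x‖ := spectralNorm_extends x
  set n := p.natDegree
  have hn : n ≠ 0 := hirr.natDegree_pos.ne'
  have hs : (p.map (algebraMap K L)).Splits := IsAlgClosed.splits _
  have hcard : (p.aroots L).card = n := by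
    rw [aroots_def, ← hs.natDegree_eq_card_roots, natDegree_map]
  have hsum : algebraMap K L (p.coeff (n - 1)) = - (p.aroots L).sum := by
    have := hs.nextCoeff_eq_neg_sum_roots_of_monic (hp.map _)
    rw [nextCoeff_map (algebraMap K L).injective, nextCoeff_of_natDegree_pos hirr.natDegree_pos]
      at this
    exact this
  set t : K := - p.coeff (n - 1) / n with ht
  by_cases h0 : p.eval t = 0
  · exact ⟨t, h0⟩
  obtain ⟨a, ha⟩ : ∃ a, a ∈ p.aroots L := Multiset.card_pos_iff_exists_mem.1 (by omega)
  have hmin : ∀ b ∈ p.aroots L, minpoly K b = p := fun b hb =>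
    (minpoly.eq_of_irreducible_of_monic hirr (mem_aroots.1 hb).2 hp).symm
  have hconj : ∀ b ∈ p.aroots L, ∃ σ : L ≃ₐ[K] L, b = σ a := fun b hb => by
    obtain ⟨σ, hσ⟩ := isConjRoot_iff_exists_algEquiv.1
      (show IsConjRoot K b a from (hmin b hb).trans (hmin a ha).symm)
    exact ⟨σ, hσ.symm⟩
  obtain ⟨u, hu⟩ := hdiv (p.eval t) n hn
  have hu0 : u ≠ 0 := by
    rintro rfl
    rw [norm_zero, zero_pow hn, eq_comm, norm_eq_zero] at hu
    exact h0 hu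
  have hnorm : f (a - algebraMap K L t) = ‖u‖ := by
    refine (pow_left_inj₀ (apply_nonneg f _) (norm_nonneg u) hn).1 ?_
    rw [hu, ← hf, ← aeval_algebraMap_apply_eq_algebraMap_eval,
      hs.aeval_eq_prod_aroots_of_monic hp, map_multiset_prod, Multiset.map_map]
    rw [Multiset.map_congr rfl (g := fun _ => f (a - algebraMap K L t)), Multiset.map_const',
      Multiset.prod_replicate, hcard]
    intro b hb
    obtain ⟨σ, rfl⟩ := hconj b hb
    rw [Function.comp_apply, map_sub_rev]
    refine Eq.trans ?_ (spectralNorm_eq_of_equiv σ _).symm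
    simp [f, spectralMulAlgNorm_def]
  set z : L := (a - algebraMap K L t) / algebraMap K L u with hz
  have hfz : f z = 1 := by
    rw [hz, map_div₀, hnorm, hf, div_self (norm_ne_zero_iff.2 hu0)]
  obtain ⟨c, hc⟩ := exists_spectralNorm_sub_lt_one i hres z hfz.le
  have hc0 : c ≠ 0 := by
    rintro rfl
    rw [map_zero, map_zero, sub_zero] at hc
    exact hc.ne hfz
  have key := spectralNorm_multiset_sum_lt_one (K := K) ((p.aroots L).map fun b =>
    (b - algebraMap K L t) / algebraMap K L u - algebraMap K L (i c)) (by
      intro x hx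
      obtain ⟨b, hb, rfl⟩ := Multiset.mem_map.1 hx
      obtain ⟨σ, rfl⟩ := hconj b hb
      rw [spectralNorm_eq_of_equiv σ] at hc
      simpa [z] using hc)
  have hval : ((p.aroots L).map fun b =>
      (b - algebraMap K L t) / algebraMap K L u - algebraMap K L (i c)).sum =
      algebraMap K L (i (- (n * c))) := by
    have hnL : (n : L) ≠ 0 := by exact_mod_cast hn
    simp only [Multiset.sum_map_sub, Multiset.sum_map_div, Multiset.map_id', Multiset.map_const',
      Multiset.sum_replicate, hcard, ht, map_neg, map_div₀, hsum, map_mul, map_natCast, nsmul_eq_mul]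
    rw [neg_neg, mul_div_cancel₀ _ hnL, sub_self, zero_div, zero_sub]
  rw [hval, spectralNorm_extends, hunit _ (by simp [hn, hc0])] at key
  exact (lt_irrefl _ key).elim

end Valued

section Novikov

open HahnSeries

variable {k : Type*} [Field k]

lemma finite_support_inter_Iic_add {x y : HahnSeries ℝ k}
    (hx : ∀ r, (x.support ∩ Set.Iic r).Finite) (hy : ∀ r, (y.support ∩ Set.Iic r).Finite) (r : ℝ) :
    ((x + y).support ∩ Set.Iic r).Finite := by
  refine ((hx r).union (hy r)).subset ?_
  rw [← Set.union_inter_distrib_right]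
  exact Set.inter_subset_inter_left _ (support_add_subset x y)

lemma finite_support_inter_Iic_mul {x y : HahnSeries ℝ k}
    (hx : ∀ r, (x.support ∩ Set.Iic r).Finite) (hy : ∀ r, (y.support ∩ Set.Iic r).Finite) (r : ℝ) :
    ((x * y).support ∩ Set.Iic r).Finite := by
  refine ((hx (r - y.order)).add (hy (r - x.order))).subset ?_
  rintro _ ⟨hs, hr⟩
  obtain ⟨a, ha, b, hb, rfl⟩ := support_mul_subset hs
  have h1 := order_le_of_coeff_ne_zero ha
  have h2 := order_le_of_coeff_ne_zero hb
  simp only [Set.mem_Iic] at hr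
  exact ⟨a, ⟨ha, by simp only [Set.mem_Iic]; linarith⟩, b,
    ⟨hb, by simp only [Set.mem_Iic]; linarith⟩, rfl⟩

lemma finite_support_single_inter_Iic (a : ℝ) (c : k) (r : ℝ) :
    ((single a c).support ∩ Set.Iic r).Finite :=
  ((Set.finite_singleton a).subset support_single_subset).inter_of_left _

variable (k) in
/-- The Hahn series over `k` with value group `ℝ` whose support meets every half-line `(-∞, r]` in
a finite set. -/
def novikovSubring : Subring (HahnSeries ℝ k) where
  carrier := {x | ∀ r : ℝ, (x.support ∩ Set.Iic r).Finite}
  mul_mem' := finite_support_inter_Iic_mul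
  add_mem' := finite_support_inter_Iic_add
  one_mem' := finite_support_single_inter_Iic 0 1
  zero_mem' := by simp
  neg_mem' := by simp

lemma mem_novikovSubring {x : HahnSeries ℝ k} :
    x ∈ novikovSubring k ↔ ∀ r : ℝ, (x.support ∩ Set.Iic r).Finite := Iff.rfl

lemma inv_mem_novikovSubring {x : HahnSeries ℝ k} (hx : x ∈ novikovSubring k) :
    x⁻¹ ∈ novikovSubring k := by
  obtain rfl | hx0 := eq_or_ne x 0
  · simp
  have hy0 := inv_ne_zero hx0
  set w : HahnSeries ℝ k := single (-x.order) x.leadingCoeff⁻¹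
  have hw : w ∈ novikovSubring k := finite_support_single_inter_Iic _ _
  set u := 1 - w * x with hu
  have hum : u ∈ novikovSubring k := sub_mem (one_mem _) (mul_mem hw hx)
  have hupos : 0 < u.orderTop :=
    unit_aux x (inv_mul_cancel₀ (leadingCoeff_ne_zero.mpr hx0)) _ (neg_add_cancel x.order)
  have hgeom (n : ℕ) : w * ∑ i ∈ Finset.range n, u ^ i = x⁻¹ - u ^ n * x⁻¹ := by
    have := mul_neg_geom_sum u n
    rw [show 1 - u = w * x by rw [hu]; ring] at this
    rw [← one_sub_mul, ← this]
    field_simp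
  intro r
  obtain ⟨n, hn⟩ : ∃ n : ℕ, ∀ s ≤ r, (u ^ n * x⁻¹).coeff s = 0 := by
    obtain h0 | h0 := eq_or_ne u 0
    · exact ⟨1, by simp [h0]⟩
    · have hpos : 0 < u.order := by
        rw [← order_eq_orderTop_of_ne_zero h0] at hupos
        exact_mod_cast hupos
      obtain ⟨n, hn⟩ := exists_nat_gt ((r - x⁻¹.order) / u.order)
      refine ⟨n, fun s hs => coeff_eq_zero_of_lt_order ?_⟩
      rw [order_mul (pow_ne_zero n h0) hy0, order_pow, nsmul_eq_mul]
      rw [div_lt_iff₀ hpos] at hn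
      linarith
  refine ((mul_mem hw (sum_mem fun i _ => pow_mem hum i) :
    w * ∑ i ∈ Finset.range n, u ^ i ∈ novikovSubring k) r).subset ?_
  rintro s ⟨hs, hsr⟩
  refine ⟨?_, hsr⟩
  rw [hgeom, mem_support, coeff_sub, hn s hsr, sub_zero]
  exact hs

variable (k) in
/-- The universal Novikov field over `k`. -/
def novikovField : Subfield (HahnSeries ℝ k) where
  __ := novikovSubring k
  inv_mem' _ := inv_mem_novikovSubring

lemma mem_novikovField {x : HahnSeries ℝ k} :
    x ∈ novikovField k ↔ ∀ r : ℝ, (x.support ∩ Set.Iic r).Finite := Iff.rfl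

lemma single_mem_novikovField (a : ℝ) (c : k) : single a c ∈ novikovField k :=
  finite_support_single_inter_Iic a c

lemma C_mem_novikovField (c : k) : C c ∈ novikovField k :=
  single_mem_novikovField 0 c

/-- The absolute value `exp (-order x)` of a Hahn series `x` with real exponents. -/
noncomputable def expNegOrder (x : HahnSeries ℝ k) : ℝ :=
  open Classical in if x = 0 then 0 else Real.exp (-x.order)

lemma expNegOrder_of_ne_zero {x : HahnSeries ℝ k} (hx : x ≠ 0) :
    expNegOrder x = Real.exp (-x.order) := if_neg hx

@[simp]
lemma expNegOrder_zero : expNegOrder (0 : HahnSeries ℝ k) = 0 := if_pos rfl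

lemma expNegOrder_le_exp_neg_iff {x : HahnSeries ℝ k} {r : ℝ} :
    expNegOrder x ≤ Real.exp (-r) ↔ ∀ s < r, x.coeff s = 0 := by
  obtain rfl | hx := eq_or_ne x 0
  · simp [Real.exp_nonneg]
  · rw [expNegOrder_of_ne_zero hx, Real.exp_le_exp, neg_le_neg_iff, le_order_iff_forall hx]

lemma expNegOrder_lt_exp_neg_iff {x : HahnSeries ℝ k} {r : ℝ} :
    expNegOrder x < Real.exp (-r) ↔ ∀ s ≤ r, x.coeff s = 0 := by
  obtain rfl | hx := eq_or_ne x 0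
  · simp [Real.exp_pos]
  · rw [expNegOrder_of_ne_zero hx, Real.exp_lt_exp, neg_lt_neg_iff]
    refine ⟨fun h s hs => coeff_eq_zero_of_lt_order (hs.trans_lt h), fun h => ?_⟩
    by_contra! hr
    exact coeff_order_eq_zero.not.2 hx (h _ hr)

lemma expNegOrder_nonneg (x : HahnSeries ℝ k) : 0 ≤ expNegOrder x := by
  unfold expNegOrder; split_ifs <;> positivity

lemma expNegOrder_eq_zero {x : HahnSeries ℝ k} : expNegOrder x = 0 ↔ x = 0 := by
  unfold expNegOrder; split_ifs <;> simp_all [Real.exp_ne_zero]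

lemma expNegOrder_mul (x y : HahnSeries ℝ k) :
    expNegOrder (x * y) = expNegOrder x * expNegOrder y := by
  obtain rfl | hx := eq_or_ne x 0
  · simp
  obtain rfl | hy := eq_or_ne y 0
  · simp
  rw [expNegOrder_of_ne_zero hx, expNegOrder_of_ne_zero hy,
    expNegOrder_of_ne_zero (mul_ne_zero hx hy), order_mul hx hy, neg_add, Real.exp_add]

lemma expNegOrder_single (a : ℝ) {c : k} (hc : c ≠ 0) :
    expNegOrder (single a c) = Real.exp (-a) := by
  rw [expNegOrder_of_ne_zero (by simpa using hc), order_single hc]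

lemma expNegOrder_add_le_max (x y : HahnSeries ℝ k) :
    expNegOrder (x + y) ≤ max (expNegOrder x) (expNegOrder y) := by
  obtain rfl | hx := eq_or_ne x 0
  · simp
  obtain rfl | hy := eq_or_ne y 0
  · simp
  rw [expNegOrder_of_ne_zero hx, expNegOrder_of_ne_zero hy,
    ← Real.exp_monotone.map_max, max_neg_neg, expNegOrder_le_exp_neg_iff]
  intro s hs
  rw [lt_min_iff] at hs
  rw [coeff_add, coeff_eq_zero_of_lt_order hs.1, coeff_eq_zero_of_lt_order hs.2, add_zero]

variable (k) in
/-- The absolute value `exp (-order x)` on Hahn series with real exponents. -/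
noncomputable def hahnAbsoluteValue : AbsoluteValue (HahnSeries ℝ k) ℝ where
  toFun := expNegOrder
  map_mul' := expNegOrder_mul
  nonneg' := expNegOrder_nonneg
  eq_zero' _ := expNegOrder_eq_zero
  add_le' x y := (expNegOrder_add_le_max x y).trans
    (max_le_add_of_nonneg (expNegOrder_nonneg x) (expNegOrder_nonneg y))

noncomputable instance : NontriviallyNormedField (novikovField k) where
  __ := ((hahnAbsoluteValue k).comp (novikovField k).subtype_injective).toNormedField
  non_trivial := ⟨⟨single (-1) 1, single_mem_novikovField _ _⟩,
    (by simp [expNegOrder_single] : 1 < expNegOrder (single (-1) (1 : k)))⟩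

lemma novikovField_norm_def (x : novikovField k) : ‖x‖ = expNegOrder (x : HahnSeries ℝ k) := rfl

instance : IsUltrametricDist (novikovField k) :=
  IsUltrametricDist.isUltrametricDist_of_forall_norm_add_le_max_norm
    fun x y => expNegOrder_add_le_max (x : HahnSeries ℝ k) y

lemma isPWO_of_finite_inter_Iic {s : Set ℝ} (hs : ∀ r, (s ∩ Set.Iic r).Finite) : s.IsPWO := by
  rw [Set.isPWO_iff_isWF, Set.isWF_iff_no_descending_seq]
  intro f hf hfs
  refine Set.infinite_range_of_injective hf.injective ((hs (f 0)).subset ?_)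
  rintro _ ⟨n, rfl⟩
  exact ⟨hfs n, hf.antitone n.zero_le⟩

instance : CompleteSpace (novikovField k) := by
  refine Metric.complete_of_cauchySeq_tendsto fun u hu => ?_
  have h (r : ℝ) : ∃ N, ∀ m ≥ N, ∀ n ≥ N, ∀ s ≤ r,
      (u m : HahnSeries ℝ k).coeff s = (u n : HahnSeries ℝ k).coeff s := by
    obtain ⟨N, hN⟩ := Metric.cauchySeq_iff.1 hu _ (Real.exp_pos (-r))
    refine ⟨N, fun m hm n hn s hs => sub_eq_zero.1 ?_⟩
    have := hN m hm n hn
    rw [dist_eq_norm, novikovField_norm_def, expNegOrder_lt_exp_neg_iff] at this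
    simpa using this s hs
  choose N hN using h
  set c : ℝ → k := fun s => (u (N s) : HahnSeries ℝ k).coeff s
  have hc (r : ℝ) (m : ℕ) (hm : N r ≤ m) (s : ℝ) (hs : s ≤ r) :
      (u m : HahnSeries ℝ k).coeff s = c s :=
    (hN r _ hm _ (le_max_left (N r) (N s)) s hs).trans
      (hN s _ (le_max_right (N r) (N s)) _ le_rfl s le_rfl)
  have hfin (r : ℝ) : (Function.support c ∩ Set.Iic r).Finite := by
    refine (mem_novikovField.1 (u (N r)).2 r).subset fun s hs => ⟨?_, hs.2⟩
    rw [mem_support, hc r _ le_rfl s hs.2]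
    exact hs.1
  refine ⟨⟨⟨c, isPWO_of_finite_inter_Iic hfin⟩, hfin⟩, Metric.tendsto_atTop.2 fun ε hε =>
    ⟨N (-Real.log ε), fun m hm => ?_⟩⟩
  rw [dist_eq_norm, novikovField_norm_def]
  conv_rhs => rw [← Real.exp_log hε, ← neg_neg (Real.log ε)]
  rw [expNegOrder_lt_exp_neg_iff]
  intro s hs
  simpa [sub_eq_zero] using hc _ m hm s hs

instance [IsAlgClosed k] [CharZero k] : IsAlgClosed (novikovField k) := by
  refine isAlgClosed_of_residue (k := k)
    ((C : k →+* HahnSeries ℝ k).codRestrict (novikovField k) C_mem_novikovField)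
    (fun x hx => ⟨(x : HahnSeries ℝ k).coeff 0, ?_⟩) (fun c hc => ?_) (fun x n hn => ?_)
  · rw [novikovField_norm_def, ← Real.exp_zero, ← neg_zero, expNegOrder_le_exp_neg_iff] at hx
    rw [novikovField_norm_def, ← Real.exp_zero, ← neg_zero (G := ℝ), expNegOrder_lt_exp_neg_iff]
    intro s hs
    obtain rfl | hs := hs.eq_or_lt
    · simp
    · simp [hx s hs, hs.ne]
  · exact (expNegOrder_single 0 hc).trans (by simp)
  · obtain rfl | hx := eq_or_ne x 0
    · exact ⟨0, by simp [hn]⟩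
    · refine ⟨⟨single ((x : HahnSeries ℝ k).order / n) 1, single_mem_novikovField _ _⟩, ?_⟩
      rw [novikovField_norm_def, novikovField_norm_def, expNegOrder_single _ one_ne_zero,
        expNegOrder_of_ne_zero (by simpa using hx), ← Real.exp_nat_mul]
      congr 1
      field_simp

end Novikov

/-- Let `k` be an algebraically closed field of characteristic zero.
The universal Novikov field `Λ` over `k` — the set of Hahn series over `k` with value
group `ℝ` whose support meets every half-line `(-∞, r]` in a finite set — is a subfield
of the field of Hahn series, and every polynomial of positive degree with coefficients
in this subfield has a root in it. -/
theorem novikov_field_isAlgClosed (k : Type) [Field k] [IsAlgClosed k] [CharZero k] :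
    ∃ Λ : Subfield (HahnSeries ℝ k),
      (Λ : Set (HahnSeries ℝ k)) =
        {x : HahnSeries ℝ k | ∀ r : ℝ, (x.support ∩ Set.Iic r).Finite} ∧
      ∀ p : Polynomial Λ, 0 < p.degree → ∃ z : Λ, p.IsRoot z := by
  exact ⟨novikovField k, rfl, fun p hp => IsAlgClosed.exists_root p hp.ne'⟩
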